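/- Let Ω be a compact metric space, let ψ₁,…,ψ_m : Ω → ℝ be continuous, let γ ∈ ℝ^m, and let 𝒫 be the set of Borel probability measures P on Ω with ∫_Ω ψ_i dP ≤ γ_i for every i = 1,…,m. Let Q : Ω → ℝ be continuous. Then sup_{P ∈ 𝒫} ∫_Ω Q dP equals the supremum, over all finite families ξ₁,…,ξ_n ∈ Ω and p₁,…,p_n ≥ 0 with Σ_j p_j = 1 such that the finitely supported measure Σ_j p_j δ_{ξ_j} belongs to 𝒫, of Σ_{j=1}^n p_j Q(ξ_j). In words, the worst-case expectation over the moment-based ambiguity set equals the supremum of the corresponding discrete-distribution problems over all finite scenario sets. (This is the discrete reformulation asserted in Proposition 2 of the paper.) -/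

import Mathlib

open MeasureTheory

/-- In a finite-dimensional space the convex hull of a compact set is compact. -/
theorem IsCompact.convexHull_of_finiteDimensional {E : Type*} [NormedAddCommGroup E]
    [NormedSpace ℝ E] [FiniteDimensional ℝ E] {s : Set E} (hs : IsCompact s) :
    IsCompact (convexHull ℝ s) := by
  let combos : ℕ → Set E := fun n =>
    (fun q : (Fin n → ℝ) × (Fin n → E) => ∑ j, q.1 j • q.2 j) ''
      (stdSimplex ℝ (Fin n) ×ˢ Set.univ.pi fun _ => s)
  have hcombos : convexHull ℝ s = ⋃ n ∈ Set.Iic (Module.finrank ℝ E + 1), combos n := by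
    apply Set.Subset.antisymm
    · intro x hx
      obtain ⟨ι, _, z, w, hz, hind, hw, hw1, hsum⟩ := eq_pos_convex_span_of_mem_convexHull hx
      let e := Fintype.equivFin ι
      have hcard : Fintype.card ι ≤ Module.finrank ℝ E + 1 :=
        hind.card_le_finrank_succ.trans (by gcongr; exact Submodule.finrank_le _)
      refine Set.mem_biUnion hcard
        ⟨(w ∘ e.symm, z ∘ e.symm), ⟨⟨fun j => (hw _).le, ?_⟩, fun j _ => hz ⟨_, rfl⟩⟩, ?_⟩
      · simpa using (e.symm.sum_comp w).trans hw1
      · simpa using (e.symm.sum_comp fun i => w i • z i).trans hsum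
    · refine Set.iUnion₂_subset fun n _ => ?_
      rintro _ ⟨⟨w, z⟩, ⟨hw, hz⟩, rfl⟩
      exact mem_convexHull_of_exists_fintype w z hw.1 hw.2 (fun i => hz i trivial) rfl
  rw [hcombos]
  refine (Set.finite_Iic _).isCompact_biUnion fun n _ => ?_
  exact ((isCompact_stdSimplex ℝ (Fin n)).prod (isCompact_univ_pi fun _ => hs)).image (by fun_prop)

/-- The integral of a continuous finite-dimensional function against a probability measure on a
compact space is attained by a finitely supported probability measure. -/
theorem exists_fin_sum_smul_eq_integral {Ω E : Type*} [TopologicalSpace Ω] [CompactSpace Ω]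
    [MeasurableSpace Ω] [BorelSpace Ω] [NormedAddCommGroup E] [NormedSpace ℝ E]
    [FiniteDimensional ℝ E] (P : Measure Ω) [IsProbabilityMeasure P] {F : Ω → E}
    (hF : Continuous F) (hFi : Integrable F P) :
    ∃ (n : ℕ) (ξ : Fin n → Ω) (p : Fin n → ℝ),
      (∀ j, 0 ≤ p j) ∧ ∑ j, p j = 1 ∧ ∑ j, p j • F (ξ j) = ∫ ω, F ω ∂P := by
  have hmem : ∫ ω, F ω ∂P ∈ convexHull ℝ (Set.range F) :=
    (convex_convexHull ℝ _).integral_mem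
      (isCompact_range hF).convexHull_of_finiteDimensional.isClosed
      (.of_forall fun ω => subset_convexHull ℝ _ ⟨ω, rfl⟩) hFi
  obtain ⟨ι, _, w, z, hw, hw1, hz, hsum⟩ := mem_convexHull_iff_exists_fintype.1 hmem
  choose ξ hξ using hz
  let e := Fintype.equivFin ι
  refine ⟨_, ξ ∘ e.symm, w ∘ e.symm, fun j => hw _, ?_, ?_⟩
  · simpa using (e.symm.sum_comp w).trans hw1
  · simpa [hξ] using (e.symm.sum_comp fun i => w i • z i).trans hsum

theorem integral_sum_ofReal_smul_dirac {Ω ι : Type*} [MeasurableSpace Ω]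
    [MeasurableSingletonClass Ω] [Fintype ι] (ξ : ι → Ω) {p : ι → ℝ} (hp : ∀ j, 0 ≤ p j)
    (f : Ω → ℝ) :
    ∫ ω, f ω ∂(∑ j, ENNReal.ofReal (p j) • Measure.dirac (ξ j)) = ∑ j, p j * f (ξ j) := by
  rw [integral_finsetSum_measure fun j _ =>
    (integrable_dirac (by simp)).smul_measure ENNReal.ofReal_ne_top]
  simp [integral_smul_measure, hp]

theorem isProbabilityMeasure_sum_ofReal_smul_dirac {Ω ι : Type*} [MeasurableSpace Ω]
    [Fintype ι] (ξ : ι → Ω) {p : ι → ℝ} (hp : ∀ j, 0 ≤ p j) (hp1 : ∑ j, p j = 1) :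
    IsProbabilityMeasure (∑ j, ENNReal.ofReal (p j) • Measure.dirac (ξ j)) :=
  ⟨by simp [← ENNReal.ofReal_sum_of_nonneg fun j _ => hp j, hp1]⟩

/-- Proposition 2 (discrete reformulation): the worst-case expectation over the
moment-based ambiguity set equals the supremum of the corresponding
discrete-distribution problems over all finite scenario sets. -/
theorem stmt3 {Ω : Type*} [MetricSpace Ω] [CompactSpace Ω]
    [MeasurableSpace Ω] [BorelSpace Ω]
    (m : ℕ) (ψ : Fin m → Ω → ℝ) (hψ : ∀ i, Continuous (ψ i)) (γ : Fin m → ℝ)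
    (Pamb : Set (Measure Ω))
    (hPamb : Pamb = {P : Measure Ω | IsProbabilityMeasure P ∧ ∀ i, ∫ ω, ψ i ω ∂P ≤ γ i})
    (Q : Ω → ℝ) (hQ : Continuous Q) :
    sSup ((fun P : Measure Ω => ∫ ω, Q ω ∂P) '' Pamb) =
      sSup {x : ℝ | ∃ (n : ℕ) (ξ : Fin n → Ω) (p : Fin n → ℝ),
        (∀ j, 0 ≤ p j) ∧ ∑ j, p j = 1 ∧
        (∑ j, ENNReal.ofReal (p j) • Measure.dirac (ξ j)) ∈ Pamb ∧
        x = ∑ j, p j * Q (ξ j)} := by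
  subst hPamb
  congr 1
  ext x
  constructor
  · rintro ⟨P, ⟨_, hP⟩, rfl⟩
    have hint : ∀ f : Ω → ℝ, Continuous f → Integrable f P := fun f hf =>
      hf.integrable_of_hasCompactSupport (.of_compactSpace f)
    have hψi : Integrable (fun ω i => ψ i ω) P := .of_eval fun i => hint _ (hψ i)
    obtain ⟨n, ξ, p, hp, hp1, hsum⟩ := exists_fin_sum_smul_eq_integral P
      (F := fun ω => ((fun i => ψ i ω), Q ω)) (by fun_prop) (hψi.prodMk (hint Q hQ))
    rw [integral_pair hψi (hint Q hQ)] at hsum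
    refine ⟨n, ξ, p, hp, hp1,
      ⟨isProbabilityMeasure_sum_ofReal_smul_dirac ξ hp hp1, fun i => ?_⟩, ?_⟩
    · have h := congrFun (congrArg Prod.fst hsum) i
      simp only [Prod.fst_sum, Finset.sum_apply, Prod.smul_fst, Pi.smul_apply, smul_eq_mul,
        eval_integral fun i => hint _ (hψ i)] at h
      rw [integral_sum_ofReal_smul_dirac ξ hp, h]
      exact hP i
    · simpa [Prod.snd_sum] using (congrArg Prod.snd hsum).symm
  · rintro ⟨n, ξ, p, hp, -, hmem, rfl⟩
    exact ⟨_, hmem, integral_sum_ofReal_smul_dirac ξ hp Q⟩
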